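/- The intersection of the Shalika subgroup with its transpose is the diagonal copy of GL2: S ∩ Sᵀ = Δ(GL2). -/

import Mathlib

open Matrix Pointwise

/-- 2×2 matrices over `k`. -/
abbrev M2 (k : Type*) [Field k] := Matrix (Fin 2) (Fin 2) k

/-- 6×6 matrices over `k`. -/
abbrev M6 (k : Type*) [Field k] := Matrix (Fin 6) (Fin 6) k

variable {k : Type*} [Field k]

/-- The 2×2 matrix `J = [[0,-1],[1,0]]`. -/
def Jmat : M2 k := !![0, -1; 1, 0]

/-- Build a 6×6 matrix from a 3×3 array of 2×2 blocks. -/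
def blk (M : Fin 3 → Fin 3 → M2 k) : M6 k :=
  Matrix.of fun i j =>
    M ⟨i.val / 2, by have := i.isLt; omega⟩ ⟨j.val / 2, by have := j.isLt; omega⟩
      ⟨i.val % 2, by have := i.isLt; omega⟩ ⟨j.val % 2, by have := j.isLt; omega⟩

/-- Block diagonal 6×6 matrix with 2×2 blocks `g`, `h`, `m`. -/
def bdiag (g h m : M2 k) : M6 k := blk ![![g, 0, 0], ![0, h, 0], ![0, 0, m]]

/-- The block upper unitriangular matrix `[[I,X,Z],[0,I,Y],[0,0,I]]`. -/
def Umat (X Y Z : M2 k) : M6 k := blk ![![1, X, Z], ![0, 1, Y], ![0, 0, 1]]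

/-- The 6×6 matrix `J3` with 2×2 blocks `[[0,0,J],[0,J,0],[J,0,0]]`. -/
def J3 : M6 k := blk ![![0, 0, Jmat], ![0, Jmat, 0], ![Jmat, 0, 0]]

/-- The group of symplectic similitudes `GSp6(k)`, as a subset of the 6×6 matrices. -/
def GSp6 (k : Type*) [Field k] : Set (M6 k) :=
  {g | IsUnit g ∧ ∃ l : kˣ, g * J3 * gᵀ = (l : k) • (J3 : M6 k)}

/-- The Levi subgroup `L3 = { blockdiag(g, h, det(g⁻¹h)·g) }`. -/
def L3 (k : Type*) [Field k] : Set (M6 k) :=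
  {m | ∃ g h : M2 k, IsUnit g ∧ IsUnit h ∧ m = bdiag g h ((g⁻¹ * h).det • g)}

/-- The unipotent radical `U3`. -/
def U3 (k : Type*) [Field k] : Set (M6 k) :=
  {m | ∃ X Y Z : M2 k, X * Jmat + Jmat * Yᵀ = 0 ∧
    Z * Jmat + Jmat * Zᵀ = -(X * Jmat * Xᵀ) ∧ m = Umat X Y Z}

/-- The parabolic subgroup `Q3 = L3 · U3`. -/
def Q3 (k : Type*) [Field k] : Set (M6 k) := L3 k * U3 k

/-- The diagonal embedding `Δ(g) = blockdiag(g,g,g)`. -/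
def Dmat (g : M2 k) : M6 k := bdiag g g g

/-- The diagonal copy `Δ(GL2)` of `GL2` in `GSp6`. -/
def DeltaGL2 (k : Type*) [Field k] : Set (M6 k) := {m | ∃ g : M2 k, IsUnit g ∧ m = Dmat g}

/-- The embedding `η(g) = blockdiag(I, g, det(g)·I)`. -/
def etaMat (g : M2 k) : M6 k := bdiag 1 g (g.det • (1 : M2 k))

/-- The copy `η(GL2)` of `GL2` in `GSp6`. -/
def etaGL2 (k : Type*) [Field k] : Set (M6 k) := {m | ∃ g : M2 k, IsUnit g ∧ m = etaMat g}

/-- The Shalika subgroup `S = Δ(GL2) · U3`. -/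
def Sgrp (k : Type*) [Field k] : Set (M6 k) := DeltaGL2 k * U3 k

/-- For a subset `H` of the 6×6 matrices, `Hᵀ = { hᵀ : h ∈ H }`. -/
def setT (H : Set (M6 k)) : Set (M6 k) := Matrix.transpose '' H

/-- The Weyl element `a = blockdiag(J, I, J)`. -/
def amat : M6 k := bdiag Jmat 1 Jmat

/-- The Weyl element `c = blockdiag(I, J, I)`. -/
def cmat : M6 k := bdiag 1 Jmat 1

/-- The Weyl element `b`. -/
def bmat : M6 k :=
  !![1,0,0,0,0,0; 0,0,1,0,0,0; 0,-1,0,0,0,0; 0,0,0,0,1,0; 0,0,0,-1,0,0; 0,0,0,0,0,1]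

/-- The set `Σ = {1, b, b·c·b, b·a·c·b, b·c·a·b·a·c·b}` of double coset representatives. -/
def SigmaSet (k : Type*) [Field k] : Set (M6 k) :=
  {1, bmat, bmat * cmat * bmat, bmat * amat * cmat * bmat,
    bmat * cmat * amat * bmat * amat * cmat * bmat}

theorem blk_mul_aux (M N : Fin 3 → Fin 3 → M2 k) :
    blk M * blk N = blk (fun i j => ∑ l, M i l * N l j) := by
  ext i j
  simp only [blk, Matrix.mul_apply, Matrix.of_apply, Matrix.sum_apply, Fin.sum_univ_succ,
    Fin.sum_univ_zero]
  simp
  ring_nf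

theorem blk_inj_aux {M N : Fin 3 → Fin 3 → M2 k} (h : blk M = blk N) : M = N := by
  funext a b
  ext i j
  have := congrFun (congrFun h ⟨2 * a.val + i.val, by omega⟩) ⟨2 * b.val + j.val, by omega⟩
  simp only [blk, Matrix.of_apply] at this
  convert this using 2 <;> (ext; simp; omega)

theorem blk_transpose_aux (M : Fin 3 → Fin 3 → M2 k) :
    (blk M)ᵀ = blk (fun i j => (M j i)ᵀ) := rfl

theorem Dmat_mul_Umat (g X Y Z : M2 k) :
    Dmat g * Umat X Y Z = blk ![![g, g * X, g * Z], ![0, g, g * Y], ![0, 0, g]] := by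
  rw [Dmat, bdiag, Umat, blk_mul_aux]
  congr 1
  funext i j
  fin_cases i <;> fin_cases j <;> simp [Fin.sum_univ_succ]

theorem mem_U3_one : (1 : M6 k) ∈ U3 k := by
  refine ⟨0, 0, 0, by simp, by simp, ?_⟩
  ext i j
  fin_cases i <;> fin_cases j <;> rfl

/-- The intersection of the Shalika subgroup with its transpose is the diagonal
copy of `GL2`: `S ∩ Sᵀ = Δ(GL2)`. -/
theorem shalika_inter_transpose (k : Type*) [Field k] :
    Sgrp k ∩ setT (Sgrp k) = DeltaGL2 k := by
  ext m
  constructor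
  · rintro ⟨⟨_, ⟨g, hg, rfl⟩, _, ⟨X, Y, Z, -, -, rfl⟩, rfl⟩,
      _, ⟨_, ⟨g', hg', rfl⟩, _, ⟨X', Y', Z', -, -, rfl⟩, rfl⟩, h⟩
    refine ⟨g, hg, ?_⟩
    simp only [Dmat_mul_Umat, blk_transpose_aux] at h ⊢
    have h := blk_inj_aux h
    have h1 := congrFun (congrFun h 0) 1
    have h2 := congrFun (congrFun h 0) 2
    have h3 := congrFun (congrFun h 1) 2
    simp at h1 h2 h3
    rw [← h1, ← h2, ← h3]
    rfl
  · rintro ⟨g, hg, rfl⟩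
    refine ⟨⟨Dmat g, ⟨g, hg, rfl⟩, 1, mem_U3_one, mul_one _⟩, Dmat gᵀ,
      ⟨Dmat gᵀ, ⟨gᵀ, (Matrix.isUnit_transpose g).2 hg, rfl⟩, 1, mem_U3_one, mul_one _⟩, ?_⟩
    rw [Dmat, bdiag, blk_transpose_aux, Dmat, bdiag]
    congr 1
    funext i j
    fin_cases i <;> fin_cases j <;> simp
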